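/- There exist constants c, C > 0 such that for every z = E + iη with η ∈ (0,1), |E| ≤ 3, and either |E| ≤ 2 or |E| − 2 ≤ η, and for every t ∈ [0,1]: c·√(κ(E)+η) ≤ Im m_sc(z_t) ≤ C·√(κ(E)+η). -/

import Mathlib

open Real MeasureTheory

/-- The semicircle density. -/
noncomputable def ρsc (E : ℝ) : ℝ := if |E| ≤ 2 then Real.sqrt (4 - E ^ 2) / (2 * Real.pi) else 0

/-- The Stieltjes transform of the semicircle density. -/
noncomputable def msc (z : ℂ) : ℂ := ∫ x : ℝ, (ρsc x : ℂ) / ((x : ℂ) - z)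

/-- The characteristic started at `z`. -/
noncomputable def charz (z : ℂ) (t : ℝ) : ℂ :=
  z * (Real.cosh (t / 2) : ℂ) + (z + 2 * msc z) * (Real.sinh (t / 2) : ℂ)

/-- Distance of `z` to the spectral edges `±2`. -/
noncomputable def kap (E : ℝ) : ℝ := min |E - 2| |E + 2|

theorem one_add_mul_mem_slitPlane {w u : ℂ} (hw : ‖w‖ < 1) (hu : ‖u‖ = 1) :
    1 + w * u ∈ Complex.slitPlane := by
  apply Complex.mem_slitPlane_of_norm_lt_one
  rwa [norm_mul, hu, mul_one]

theorem norm_exp_neg_ofReal_mul_I (θ : ℝ) : ‖Complex.exp (-(θ * Complex.I))‖ = 1 := by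
  have := Complex.norm_exp_ofReal_mul_I (-θ)
  rwa [Complex.ofReal_neg, neg_mul] at this

theorem continuous_joukowski_kernel {w : ℂ} (hw : ‖w‖ < 1) :
    Continuous fun θ : ℝ => 1 / (1 + w * Complex.exp (θ * Complex.I)) +
      1 / (1 + w * Complex.exp (-(θ * Complex.I))) - 1 := by
  refine ((continuous_const.div (by fun_prop) fun θ => ?_).add
    (continuous_const.div (by fun_prop) fun θ => ?_)).sub continuous_const
  · exact Complex.slitPlane_ne_zero
      (one_add_mul_mem_slitPlane hw (Complex.norm_exp_ofReal_mul_I θ))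
  · exact Complex.slitPlane_ne_zero
      (one_add_mul_mem_slitPlane hw (norm_exp_neg_ofReal_mul_I θ))

theorem integral_joukowski_kernel (w : ℂ) (hw : ‖w‖ < 1) :
    ∫ θ in (0 : ℝ)..π, (1 / (1 + w * Complex.exp (θ * Complex.I)) +
      1 / (1 + w * Complex.exp (-(θ * Complex.I))) - 1) = π := by
  have hderiv : ∀ θ : ℝ, HasDerivAt (fun θ : ℝ => (θ : ℂ) +
      Complex.I * Complex.log (1 + w * Complex.exp (θ * Complex.I)) -
      Complex.I * Complex.log (1 + w * Complex.exp (-(θ * Complex.I))))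
      (1 / (1 + w * Complex.exp (θ * Complex.I)) +
      1 / (1 + w * Complex.exp (-(θ * Complex.I))) - 1) θ := by
    intro θ
    have hs1 := one_add_mul_mem_slitPlane hw (Complex.norm_exp_ofReal_mul_I θ)
    have hs2 := one_add_mul_mem_slitPlane hw (norm_exp_neg_ofReal_mul_I θ)
    have h0 : HasDerivAt (fun θ : ℝ => (θ : ℂ)) 1 θ := Complex.ofRealCLM.hasDerivAt
    have hI := h0.mul_const Complex.I
    have h1 := ((hI.cexp.const_mul w).const_add 1).clog_real hs1
    have h2 := ((hI.fun_neg.cexp.const_mul w).const_add 1).clog_real hs2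
    refine ((h0.fun_add (h1.const_mul Complex.I)).fun_sub (h2.const_mul Complex.I)).congr_deriv ?_
    have e1 := Complex.slitPlane_ne_zero hs1
    have e2 := Complex.slitPlane_ne_zero hs2
    generalize Complex.exp (θ * Complex.I) = p at e1 ⊢
    generalize Complex.exp (-(θ * Complex.I)) = q at e2 ⊢
    field_simp
    linear_combination (w * p * (1 + w * q) + w * q * (1 + w * p)) * Complex.I_sq
  rw [intervalIntegral.integral_eq_sub_of_hasDerivAt (fun θ _ => hderiv θ)
    ((continuous_joukowski_kernel hw).intervalIntegrable _ _)]
  simp [Complex.exp_neg, Complex.exp_pi_mul_I]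

/-- Joukowski form of the Stieltjes transform: `msc` inverts `w ↦ -(w + w⁻¹)` on the
upper half of the unit disc. -/
theorem msc_neg_add_inv (w : ℂ) (hw : ‖w‖ < 1) (him : 0 < w.im) :
    msc (-(w + w⁻¹)) = w := by
  have hw0 : w ≠ 0 := by rintro rfl; simp at him
  set z : ℂ := -(w + w⁻¹) with hz
  have hzim : z.im ≠ 0 := by
    have hsq : w.re * w.re + w.im * w.im < 1 := by
      rw [← Complex.normSq_apply, Complex.normSq_eq_norm_sq]; nlinarith [norm_nonneg w]
    have hpos : 0 < w.re * w.re + w.im * w.im := by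
      linarith [mul_self_nonneg w.re, mul_pos him him]
    have : z.im = w.im * (1 - (w.re * w.re + w.im * w.im)) / (w.re * w.re + w.im * w.im) := by
      simp only [hz, Complex.neg_im, Complex.add_im, Complex.inv_im, Complex.normSq_apply]
      field_simp
      ring
    rw [this]
    have : 0 < 1 - (w.re * w.re + w.im * w.im) := by linarith
    positivity
  have hxz : ∀ x : ℝ, (x : ℂ) - z ≠ 0 := by
    intro x h
    apply hzim
    rw [← sub_eq_zero.mp h, Complex.ofReal_im]
  have hint : msc z = ∫ x in (-2 : ℝ)..2,
      ((√(4 - x ^ 2) / (2 * π) : ℝ) : ℂ) / ((x : ℂ) - z) := by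
    rw [intervalIntegral.integral_of_le (by norm_num), ← integral_Icc_eq_integral_Ioc,
      ← integral_indicator measurableSet_Icc, msc]
    congr 1
    ext x
    by_cases hx : |x| ≤ 2
    · rw [Set.indicator_of_mem (Set.mem_Icc.mpr (abs_le.mp hx)), ρsc, if_pos hx]
    · rw [Set.indicator_of_notMem (fun h => hx (abs_le.mpr (Set.mem_Icc.mp h))), ρsc, if_neg hx]
      simp
  have hsub : ∫ x in (-2 : ℝ)..2, ((√(4 - x ^ 2) / (2 * π) : ℝ) : ℂ) / ((x : ℂ) - z) =
      ∫ θ in π..0, (-2 * Real.sin θ) • (((√(4 - (2 * Real.cos θ) ^ 2) / (2 * π) : ℝ) : ℂ) /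
        (((2 * Real.cos θ : ℝ) : ℂ) - z)) := by
    have h := intervalIntegral.integral_deriv_smul_comp (a := π) (b := 0)
      (f := fun θ => 2 * Real.cos θ) (f' := fun θ => -2 * Real.sin θ)
      (g := fun x : ℝ => ((√(4 - x ^ 2) / (2 * π) : ℝ) : ℂ) / ((x : ℂ) - z))
      (fun θ _ => ((Real.hasDerivAt_cos θ).const_mul 2).congr_deriv (by ring))
      (by fun_prop)
      (Continuous.div (by fun_prop) (by fun_prop) hxz)
    simp only [Real.cos_pi, Real.cos_zero, Function.comp_def] at h
    rw [h]; norm_num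
  have hpt : ∀ θ ∈ Set.uIcc (0 : ℝ) π,
      (-2 * Real.sin θ) • (((√(4 - (2 * Real.cos θ) ^ 2) / (2 * π) : ℝ) : ℂ) /
        (((2 * Real.cos θ : ℝ) : ℂ) - z)) =
      (((2 * Real.cos θ : ℝ) : ℂ) + z) / (2 * π) + (1 - w ^ 2) / w / (2 * π) *
        (1 / (1 + w * Complex.exp (θ * Complex.I)) +
          1 / (1 + w * Complex.exp (-(θ * Complex.I))) - 1) := by
    intro θ hθ
    rw [Set.uIcc_of_le pi_pos.le] at hθ
    have hs : √(4 - (2 * Real.cos θ) ^ 2) = 2 * Real.sin θ := by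
      rw [show 4 - (2 * Real.cos θ) ^ 2 = (2 * Real.sin θ) ^ 2 by
        nlinarith [Real.sin_sq_add_cos_sq θ]]
      exact sqrt_sq (by linarith [sin_nonneg_of_mem_Icc hθ])
    have hx := hxz (2 * Real.cos θ)
    rw [hs, Complex.real_smul]
    have hsc : (Complex.sin θ) ^ 2 = 1 - Complex.cos θ ^ 2 := by
      linear_combination Complex.sin_sq_add_cos_sq (θ : ℂ)
    have hcos : Complex.exp (θ * Complex.I) + Complex.exp (-(θ * Complex.I)) =
        2 * Complex.cos θ := by
      rw [Complex.two_cos, neg_mul]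
    have hee : Complex.exp (θ * Complex.I) * Complex.exp (-(θ * Complex.I)) = 1 := by
      rw [← Complex.exp_add]; simp
    set p := Complex.exp (θ * Complex.I)
    set q := Complex.exp (-(θ * Complex.I))
    have hprod : (1 + w * p) * (1 + w * q) = w * (2 * Complex.cos θ - z) := by
      rw [hz]; field_simp
      linear_combination w * hcos + w ^ 2 * hee
    push_cast at hx ⊢
    have hpq : (1 + w * p) * (1 + w * q) ≠ 0 := by
      rw [hprod]; exact mul_ne_zero hw0 hx
    have hp := left_ne_zero_of_mul hpq
    have hq := right_ne_zero_of_mul hpq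
    have hker : 1 / (1 + w * p) + 1 / (1 + w * q) - 1 =
        (1 - w ^ 2) / (w * (2 * Complex.cos θ - z)) := by
      rw [← hprod]; field_simp
      linear_combination -w ^ 2 * hee
    rw [hker]
    have hzw : z * w = -(w ^ 2 + 1) := by rw [hz]; field_simp
    field_simp
    rw [hsc]
    linear_combination (z * w - w ^ 2 - 1) * hzw
  rw [hint, hsub, intervalIntegral.integral_symm, intervalIntegral.integral_congr hpt]
  have hcos : ∫ θ in (0 : ℝ)..π, (((2 * Real.cos θ : ℝ) : ℂ) + z) / (2 * π) = z / 2 := by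
    rw [intervalIntegral.integral_div, intervalIntegral.integral_add
      (Continuous.intervalIntegrable (by fun_prop) _ _) intervalIntegrable_const,
      intervalIntegral.integral_ofReal, intervalIntegral.integral_const_mul, integral_cos]
    simp
    field_simp
  rw [intervalIntegral.integral_add (Continuous.intervalIntegrable (by fun_prop) _ _)
    (((continuous_joukowski_kernel hw).const_mul _).intervalIntegrable _ _),
    intervalIntegral.integral_const_mul, hcos, integral_joukowski_kernel w hw, hz]
  field_simp
  ring

theorem exists_neg_add_inv_eq (z : ℂ) (hz : 0 < z.im) :
    ∃ w : ℂ, ‖w‖ < 1 ∧ 0 < w.im ∧ z = -(w + w⁻¹) := by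
  have key : ∀ w : ℂ, w ≠ 0 → z = -(w + w⁻¹) →
      z.im * Complex.normSq w = w.im * (1 - Complex.normSq w) := by
    intro w hw h
    have : Complex.normSq w ≠ 0 := by simpa using hw
    rw [h]
    simp only [Complex.neg_im, Complex.add_im, Complex.inv_im]
    field_simp
    ring
  obtain ⟨s, hs⟩ := IsAlgClosed.exists_pow_nat_eq (z ^ 2 - 4) (n := 2) (by norm_num)
  set w := (-z + s) / 2 with hw
  have hquad : w ^ 2 + z * w + 1 = 0 := by rw [hw]; linear_combination hs / 4
  have hw0 : w ≠ 0 := by intro h; simp [h] at hquad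
  have hzw : z = -(w + w⁻¹) := by field_simp; linear_combination hquad
  have of_lt : ∀ w : ℂ, w ≠ 0 → z = -(w + w⁻¹) → ‖w‖ < 1 → 0 < w.im := by
    intro w h0 h hlt
    have hk := key w h0 h
    have hn : 0 < Complex.normSq w := Complex.normSq_pos.mpr h0
    have : 0 < 1 - Complex.normSq w := by
      rw [Complex.normSq_eq_norm_sq]; nlinarith [norm_nonneg w]
    exact pos_of_mul_pos_left (hk ▸ mul_pos hz hn) this.le
  rcases lt_trichotomy ‖w‖ 1 with h | h | h
  · exact ⟨w, h, of_lt w hw0 hzw h, hzw⟩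
  · have hk := key w hw0 hzw
    rw [Complex.normSq_eq_norm_sq, h] at hk
    norm_num at hk
    exact absurd hk hz.ne'
  · have hi : ‖w⁻¹‖ < 1 := by rw [norm_inv]; exact inv_lt_one_of_one_lt₀ h
    have hzi : z = -(w⁻¹ + w⁻¹⁻¹) := by rw [inv_inv, add_comm]; exact hzw
    exact ⟨w⁻¹, hi, of_lt _ (inv_ne_zero hw0) hzi hi, hzi⟩

theorem kap_eq_abs_abs_sub (E : ℝ) : kap E = |(|E| - 2)| := by
  unfold kap
  rcases le_total 0 E with h | h
  · rw [abs_of_nonneg h, min_eq_left]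
    rw [abs_of_nonneg (by linarith : 0 ≤ E + 2)]
    exact abs_le.mpr ⟨by linarith, by linarith⟩
  · rw [abs_of_nonpos h, min_eq_right, ← abs_neg (E + 2)]
    · congr 1; ring
    rw [abs_of_nonpos (by linarith : E - 2 ≤ 0)]
    exact abs_le.mpr ⟨by linarith, by linarith⟩

/-- The edge estimate in terms of `w = msc z`, with `a = |Re w|`, `b = Im w`, `X = |Re z|` and
`η = Im z`. -/
theorem sq_im_comparable {a b X η : ℝ} (ha : 0 ≤ a) (hb : 0 < b) (hr : a ^ 2 + b ^ 2 < 1)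
    (hX : X * (a ^ 2 + b ^ 2) = a * (1 + (a ^ 2 + b ^ 2)))
    (hη : η * (a ^ 2 + b ^ 2) = b * (1 - (a ^ 2 + b ^ 2)))
    (hη0 : 0 < η) (hη1 : η < 1) (hX3 : X ≤ 3) (hXη : X - 2 ≤ η) :
    b ^ 2 ≤ |X - 2| + η ∧ |X - 2| + η ≤ 3600 * b ^ 2 := by
  obtain ⟨r, hrdef⟩ : ∃ r, r = a ^ 2 + b ^ 2 := ⟨_, rfl⟩
  rw [← hrdef] at hr hX hη
  have hr0 : 0 < r := by rw [hrdef]; positivity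
  have ha1 : a < 1 := by nlinarith
  have hrlow : 1 / 25 ≤ r := by
    by_contra! h
    have h1 : a ≤ 3 * r := by nlinarith
    have h2 : b ≤ 2 * r := by nlinarith
    nlinarith
  have hid : ((X - 2) ^ 2 + η ^ 2) * r = ((1 - a) ^ 2 + b ^ 2) ^ 2 := by
    apply mul_right_cancel₀ hr0.ne'
    have e : ((X - 2) ^ 2 + η ^ 2) * r * r = (X * r - 2 * r) ^ 2 + (η * r) ^ 2 := by ring
    rw [e, hX, hη, hrdef]; ring
  have hd : 1 - a ≤ 21 * b := by
    rcases le_total a (1 / 10) with h | h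
    · have : (1 / 21) ^ 2 ≤ b ^ 2 := by nlinarith
      have := (sq_le_sq₀ (by norm_num) hb.le).mp this
      linarith
    · have h1 : a * (1 - a) ^ 2 ≤ b ^ 2 * (2 - a) + b * (1 - r) := by
        have : (X - 2) * r ≤ η * r := by gcongr
        rw [sub_mul, hX, hη] at this
        have e : a * (1 - a) ^ 2 - b ^ 2 * (2 - a) = a * (1 + r) - 2 * r := by
          rw [hrdef]; ring
        linarith
      have h2 : b * (1 - r) ≤ b * (2 * (1 - a)) := by
        apply mul_le_mul_of_nonneg_left _ hb.le
        nlinarith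
      have h3 : (1 - a) ^ 2 ≤ 20 * b ^ 2 + 20 * (b * (1 - a)) := by
        have := mul_le_mul_of_nonneg_right h (sq_nonneg (1 - a))
        have := mul_nonneg ha (sq_nonneg b)
        linarith
      by_contra! h4
      have h5 := mul_lt_mul_of_pos_left h4 hb
      have h6 := mul_lt_mul_of_pos_right h4 (by linarith : 0 < 1 - a)
      nlinarith
  have hk : 0 ≤ |X - 2| := abs_nonneg _
  have hsq : |X - 2| ^ 2 = (X - 2) ^ 2 := sq_abs _
  constructor
  · refine (sq_le_sq₀ (by positivity) (by positivity)).mp ?_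
    have h1 : ((X - 2) ^ 2 + η ^ 2) * r ≤ (X - 2) ^ 2 + η ^ 2 :=
      mul_le_of_le_one_right (by positivity) hr.le
    have h2 : (b ^ 2) ^ 2 ≤ ((1 - a) ^ 2 + b ^ 2) ^ 2 := by
      gcongr; linarith [sq_nonneg (1 - a)]
    linarith [mul_nonneg hk hη0.le, add_sq |X - 2| η]
  · have h1 : (|X - 2| + η) ^ 2 ≤ (8 * ((1 - a) ^ 2 + b ^ 2)) ^ 2 := by
      have h2 : (|X - 2| + η) ^ 2 ≤ 2 * ((X - 2) ^ 2 + η ^ 2) := by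
        nlinarith [sq_nonneg (|X - 2| - η)]
      have h3 : (X - 2) ^ 2 + η ^ 2 ≤ 25 * ((1 - a) ^ 2 + b ^ 2) ^ 2 := by
        rw [← hid]; nlinarith [sq_nonneg (X - 2), sq_nonneg η]
      nlinarith [sq_nonneg ((1 - a) ^ 2 + b ^ 2)]
    have h4 := (sq_le_sq₀ (by positivity) (by positivity)).mp h1
    have h5 : (1 - a) ^ 2 ≤ (21 * b) ^ 2 := by gcongr
    nlinarith

theorem charz_neg_add_inv (w : ℂ) (hw : ‖w‖ < 1) (him : 0 < w.im) (t : ℝ) :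
    charz (-(w + w⁻¹)) t =
      -((Real.exp (-(t / 2)) : ℂ) * w + ((Real.exp (-(t / 2)) : ℂ) * w)⁻¹) := by
  have hw0 : w ≠ 0 := by rintro rfl; simp at him
  rw [charz, msc_neg_add_inv w hw him, Real.cosh_eq, Real.sinh_eq, mul_inv,
    ← Complex.ofReal_inv, ← Real.exp_neg, neg_neg]
  push_cast
  field_simp
  ring

/-- `Im m_sc(z_t) ≍ √(κ(E)+η)` uniformly along the characteristics. -/
theorem im_msc_along_characteristic :
    ∃ c C : ℝ, 0 < c ∧ 0 < C ∧
      ∀ E η : ℝ, 0 < η → η < 1 → |E| ≤ 3 → (|E| ≤ 2 ∨ |E| - 2 ≤ η) →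
        ∀ t : ℝ, t ∈ Set.Icc (0 : ℝ) 1 →
          c * Real.sqrt (kap E + η) ≤ (msc (charz (E + η * Complex.I) t)).im ∧
            (msc (charz (E + η * Complex.I) t)).im ≤ C * Real.sqrt (kap E + η) := by
  refine ⟨1 / 120, 1, by norm_num, by norm_num, ?_⟩
  intro E η hη0 hη1 hE hdom t ⟨ht0, ht1⟩
  set z : ℂ := E + η * Complex.I with hz
  have hzim : z.im = η := by simp [hz]
  have hzre : z.re = E := by simp [hz]
  obtain ⟨w, hw, him, hzw⟩ := exists_neg_add_inv_eq z (hzim.symm ▸ hη0)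
  have hs0 : 0 < Real.exp (-(t / 2)) := Real.exp_pos _
  have hs1 : Real.exp (-(t / 2)) ≤ 1 := Real.exp_le_one_iff.mpr (by linarith)
  have hs2 : 1 / 2 ≤ Real.exp (-(t / 2)) := by linarith [Real.add_one_le_exp (-(t / 2))]
  have hm : (msc (charz z t)).im = Real.exp (-(t / 2)) * w.im := by
    rw [hzw, charz_neg_add_inv w hw him, msc_neg_add_inv, Complex.im_ofReal_mul]
    · rw [norm_mul, Complex.norm_real, Real.norm_of_nonneg hs0.le]
      exact (mul_le_of_le_one_left (norm_nonneg _) hs1).trans_lt hw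
    · rw [Complex.im_ofReal_mul]; positivity
  have hsq : Complex.normSq w = |w.re| ^ 2 + w.im ^ 2 := by
    rw [Complex.normSq_apply, sq_abs]; ring
  have hpos : 0 < |w.re| ^ 2 + w.im ^ 2 := by positivity
  have hre : |E| * (|w.re| ^ 2 + w.im ^ 2) = |w.re| * (1 + (|w.re| ^ 2 + w.im ^ 2)) := by
    have : E = -(w.re * (1 + (|w.re| ^ 2 + w.im ^ 2)) / (|w.re| ^ 2 + w.im ^ 2)) := by
      rw [← hzre, hzw]
      simp only [Complex.neg_re, Complex.add_re, Complex.inv_re, hsq]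
      field_simp
      ring
    rw [this, abs_neg, abs_div, abs_mul, abs_of_pos hpos, abs_of_pos (a := 1 + _) (by positivity)]
    field_simp
  have himz : η * (|w.re| ^ 2 + w.im ^ 2) = w.im * (1 - (|w.re| ^ 2 + w.im ^ 2)) := by
    rw [← hzim, hzw]
    simp only [Complex.neg_im, Complex.add_im, Complex.inv_im, hsq]
    field_simp
    ring
  have hlt : |w.re| ^ 2 + w.im ^ 2 < 1 := by
    rw [← hsq, Complex.normSq_eq_norm_sq]; nlinarith [norm_nonneg w]
  obtain ⟨hlow, hup⟩ := sq_im_comparable (abs_nonneg _) him hlt hre himz hη0 hη1 hE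
    (by rcases hdom with h | h <;> linarith)
  rw [← kap_eq_abs_abs_sub] at hlow hup
  have h1 : w.im ≤ √(kap E + η) := Real.le_sqrt_of_sq_le hlow
  have h2 : √(kap E + η) ≤ 60 * w.im :=
    Real.sqrt_le_iff.mpr ⟨by positivity, by linarith [mul_pow 60 w.im 2]⟩
  rw [hm]
  constructor <;> nlinarith
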